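/- The set SF_b = {X ∈ SF : X has a Schauder basis} is an analytic subset of SF. -/

import Mathlib

open MeasureTheory Set Topology

noncomputable section

/-- `C(ℝ)`: continuous real-valued functions on `ℝ` with the compact-open topology,
which coincides with the topology of uniform convergence on compact subsets of `ℝ`. -/
abbrev CR : Type := C(ℝ, ℝ)

/-- `SF`: the set of closed linear subspaces of `C(ℝ)`. -/
def SF : Set (Submodule ℝ CR) := {p | IsClosed (p : Set CR)}

/-- The Effros Borel structure on `SF`, generated by the sets
`{X ∈ SF : X ∩ U ≠ ∅}` for `U` open in `C(ℝ)`. -/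
instance : MeasurableSpace SF :=
  MeasurableSpace.generateFrom
    {A : Set SF | ∃ U : Set CR, IsOpen U ∧
      A = {X : SF | (((X : Submodule ℝ CR) : Set CR) ∩ U).Nonempty}}

/-- A subset of a measurable space is analytic if it is the image of a Polish space
under a Borel map. -/
def IsAnalyticIn {α : Type*} [MeasurableSpace α] (A : Set α) : Prop :=
  ∃ (Z : Type) (tZ : TopologicalSpace Z), @PolishSpace Z tZ ∧
    ∃ f : Z → α, @Measurable Z α (@borel Z tZ) _ f ∧ Set.range f = A

/-- `X ∈ SF` has a Schauder basis: a sequence such that every element of `X` has a unique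
representation as a convergent series with real coefficients. -/
def HasSchauderBasis (X : SF) : Prop :=
  ∃ x : ℕ → ↥(X : Submodule ℝ CR), ∀ y : ↥(X : Submodule ℝ CR),
    ∃! a : ℕ → ℝ, Filter.Tendsto (fun N => ∑ j ∈ Finset.range N, a j • x j)
      Filter.atTop (𝓝 y)

/-- The `N`-th partial sum of the series `∑ j, a j • x j`. -/
def partialSum {E : Type*} [AddCommGroup E] [Module ℝ E] (x : ℕ → E) (a : ℕ → ℝ) (N : ℕ) : E :=
  ∑ j ∈ Finset.range N, a j • x j

section Algebra

variable {E : Type*} [AddCommGroup E] [Module ℝ E] (x : ℕ → E)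

theorem partialSum_sub (a b : ℕ → ℝ) (N : ℕ) :
    partialSum x (a - b) N = partialSum x a N - partialSum x b N := by
  simp [partialSum, sub_smul]

theorem partialSum_smul (t : ℝ) (a : ℕ → ℝ) (N : ℕ) :
    partialSum x (t • a) N = t • partialSum x a N := by
  simp [partialSum, Finset.smul_sum, smul_smul]

theorem partialSum_succ (a : ℕ → ℝ) (N : ℕ) :
    partialSum x a (N + 1) = partialSum x a N + a N • x N := by
  simp [partialSum, Finset.sum_range_succ]

theorem partialSum_zero_coeff (N : ℕ) : partialSum x 0 N = 0 := by
  simp [partialSum]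

theorem map_partialSum {F : Type*} [AddCommGroup F] [Module ℝ F] (f : E →ₗ[ℝ] F) (a : ℕ → ℝ)
    (N : ℕ) : f (partialSum x a N) = partialSum (fun j => f (x j)) a N := by
  simp [partialSum]

/-- Truncating the coefficients at `l` freezes the partial sums from `l` on. -/
theorem partialSum_indicator (a : ℕ → ℝ) (l N : ℕ) :
    partialSum x ((Set.Iio l).indicator a) N = partialSum x a (min N l) := by
  induction N with
  | zero => simp [partialSum]
  | succ N ih =>
    rw [partialSum_succ, ih]
    rcases lt_or_ge N l with h | h
    · rw [min_eq_left h.le, min_eq_left (Nat.succ_le_of_lt h), partialSum_succ,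
        Set.indicator_of_mem (Set.mem_Iio.2 h)]
    · rw [min_eq_right h, min_eq_right (h.trans N.le_succ),
        Set.indicator_of_notMem (by simpa using h), zero_smul, add_zero]

theorem partialSum_mem_span (a : ℕ → ℝ) (N : ℕ) :
    partialSum x a N ∈ Submodule.span ℝ (Set.range x) :=
  Submodule.sum_mem _ fun j _ =>
    Submodule.smul_mem _ _ (Submodule.subset_span (Set.mem_range_self j))

theorem mem_span_range_iff_partialSum {y : E} :
    y ∈ Submodule.span ℝ (Set.range x) ↔ ∃ (a : ℕ → ℝ) (N : ℕ), ∀ k, N ≤ k →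
      partialSum x a k = y := by
  constructor
  · intro h
    obtain ⟨c, rfl⟩ := Finsupp.mem_span_range_iff_exists_finsupp.1 h
    obtain ⟨N, hN⟩ := c.support.exists_nat_subset_range
    refine ⟨c, N, fun k hk => ?_⟩
    exact (Finsupp.sum_of_support_subset c (hN.trans (Finset.range_mono hk))
      (fun j t => t • x j) (by simp)).symm
  · rintro ⟨a, N, h⟩
    exact h N le_rfl ▸ partialSum_mem_span x a N

end Algebra

/-- A sequence of continuous seminorms whose balls form a neighbourhood basis at `0`. -/
structure IsFundamental {E : Type*} [AddCommGroup E] [Module ℝ E] [TopologicalSpace E]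
    (p : ℕ → Seminorm ℝ E) : Prop where
  continuous : ∀ n, Continuous (p n)
  exists_ball_subset : ∀ U ∈ 𝓝 (0 : E), ∃ m, ∃ ε > 0, ∀ y, p m y < ε → y ∈ U

theorem IsFundamental.tendsto_zero_iff {E : Type*} [AddCommGroup E] [Module ℝ E]
    [TopologicalSpace E] {p : ℕ → Seminorm ℝ E} (hp : IsFundamental p) {ι : Type*} {l : Filter ι}
    {f : ι → E} : Filter.Tendsto f l (𝓝 0) ↔
      ∀ n, Filter.Tendsto (fun i => p n (f i)) l (𝓝 0) := by
  constructor
  · intro h n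
    rw [← map_zero (p n)]
    exact ((hp.continuous n).tendsto 0).comp h
  · intro h U hU
    obtain ⟨m, ε, hε, hsub⟩ := hp.exists_ball_subset U hU
    filter_upwards [(h m).eventually_lt_const hε] with i hi using hsub _ hi

theorem IsFundamental.tendsto_iff {E : Type*} [AddCommGroup E] [Module ℝ E]
    [TopologicalSpace E] [IsTopologicalAddGroup E] {p : ℕ → Seminorm ℝ E}
    (hp : IsFundamental p) {ι : Type*} {l : Filter ι}
    {f : ι → E} {y : E} : Filter.Tendsto f l (𝓝 y) ↔
      ∀ n, Filter.Tendsto (fun i => p n (f i - y)) l (𝓝 0) := by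
  rw [← hp.tendsto_zero_iff, tendsto_sub_nhds_zero_iff]

theorem IsFundamental.eq_zero {E : Type*} [AddCommGroup E] [Module ℝ E]
    [TopologicalSpace E] [T2Space E] {p : ℕ → Seminorm ℝ E} (hp : IsFundamental p) {y : E}
    (h : ∀ n, p n y = 0) : y = 0 := by
  have : Filter.Tendsto (fun _ : ℕ => y) Filter.atTop (𝓝 0) :=
    hp.tendsto_zero_iff.2 fun n => by simp [h n]
  exact tendsto_nhds_unique tendsto_const_nhds this

/-- The Grunblum condition: the initial partial sums are controlled by the later ones. -/
structure IsBasic {E : Type*} [AddCommGroup E] [Module ℝ E]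
    (p : ℕ → Seminorm ℝ E) (x : ℕ → E) : Prop where
  ne_zero : ∀ j, x j ≠ 0
  bound : ∀ n, ∃ m C : ℕ, ∀ k l, k ≤ l → ∀ a : ℕ → ℝ,
    p n (partialSum x a k) ≤ C * p m (partialSum x a l)

/-- The coefficients of a basic sequence are controlled by its partial sums. -/
theorem IsBasic.exists_coeff_bound {E : Type*} [AddCommGroup E] [Module ℝ E]
    [TopologicalSpace E] [T2Space E] {p : ℕ → Seminorm ℝ E} {x : ℕ → E} (hp : IsFundamental p)
    (hx : IsBasic p x) (j : ℕ) :
    ∃ (m : ℕ) (C : ℝ), ∀ l, j < l → ∀ a : ℕ → ℝ, |a j| ≤ C * p m (partialSum x a l) := by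
  obtain ⟨n, hn⟩ : ∃ n, p n (x j) ≠ 0 := by
    by_contra! h
    exact hx.ne_zero j (hp.eq_zero h)
  have hn : 0 < p n (x j) := lt_of_le_of_ne (apply_nonneg _ _) hn.symm
  obtain ⟨m, C, h⟩ := hx.bound n
  refine ⟨m, (C + C) / p n (x j), fun l hl a => ?_⟩
  rw [div_mul_eq_mul_div, le_div_iff₀ hn, ← Real.norm_eq_abs, ← map_smul_eq_mul]
  have : a j • x j = partialSum x a (j + 1) - partialSum x a j := by
    rw [partialSum_succ]; abel
  rw [this, add_mul]
  exact (map_sub_le_add (p n) _ _).trans (add_le_add (h _ _ hl a) (h _ _ hl.le a))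

/-- Pettis lemma: the difference set of a non-meagre set with the Baire property is a
neighbourhood of `0`. -/
theorem sub_mem_nhds_zero_of_not_isMeagre {G : Type*} [AddCommGroup G] [TopologicalSpace G]
    [IsTopologicalAddGroup G] [BaireSpace G] {A : Set G} (hA : BaireMeasurableSet A)
    (hm : ¬ IsMeagre A) : ∀ᶠ h in 𝓝 (0 : G), ∃ u ∈ A, ∃ v ∈ A, h = u - v := by
  obtain ⟨U, hU, hAU⟩ := hA.residualEq_isOpen
  have hne : U.Nonempty := by
    by_contra hemp
    rw [Set.not_nonempty_iff_eq_empty] at hemp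
    subst hemp
    apply hm
    filter_upwards [hAU] with z hz
    intro hzA
    exact (hz.mp hzA : z ∈ (∅ : Set G))
  obtain ⟨u, hu⟩ := hne
  have hev : ∀ᶠ h in 𝓝 (0 : G), u - h ∈ U := by
    have : Filter.Tendsto (fun h : G => u - h) (𝓝 0) (𝓝 (u - 0)) :=
      (continuous_const.sub continuous_id).tendsto 0
    rw [sub_zero] at this
    exact this (hU.mem_nhds hu)
  filter_upwards [hev] with h hh
  have hcont : Continuous fun z : G => z - h := continuous_id.sub continuous_const
  have hshift := tendsto_residual_of_isOpenMap hcont (Homeomorph.subRight h).isOpenMap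
  have hres : {z : G | (A z = U z) ∧ (A (z - h) = U (z - h))} ∈ residual G :=
    Filter.inter_mem hAU (hshift hAU)
  obtain ⟨z, ⟨hzU, hzhU⟩, hz, hzh⟩ := (dense_of_mem_residual hres).inter_open_nonempty
    (U ∩ (fun z => z - h) ⁻¹' U) (hU.inter (hU.preimage hcont)) ⟨u, hu, hh⟩
  exact ⟨z, hz.mpr hzU, z - h, hzh.mpr hzhU, by abel⟩

section Topology

variable {E : Type*} [AddCommGroup E] [Module ℝ E] [TopologicalSpace E]
  [IsTopologicalAddGroup E] [ContinuousSMul ℝ E] {p : ℕ → Seminorm ℝ E} {x : ℕ → E}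

theorem continuous_partialSum (x : ℕ → E) (N : ℕ) : Continuous fun a => partialSum x a N := by
  unfold partialSum
  fun_prop

theorem continuous_partialSum_vectors (a : ℕ → ℝ) (N : ℕ) :
    Continuous fun x : ℕ → E => partialSum x a N := by
  unfold partialSum
  fun_prop

/-- The partial sums of the expansions with respect to a Schauder basis of a Polish space are
bounded uniformly near `0`. -/
theorem exists_partialSum_bound_nhds [PolishSpace E] (hp : ∀ n, Continuous (p n))
    (hx : ∀ y : E, ∃! a : ℕ → ℝ, Filter.Tendsto (partialSum x a) Filter.atTop (𝓝 y)) (n : ℕ) :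
    ∃ K : ℕ, ∀ᶠ y in 𝓝 (0 : E), ∀ a : ℕ → ℝ,
      Filter.Tendsto (partialSum x a) Filter.atTop (𝓝 y) → ∀ N, p n (partialSum x a N) ≤ K := by
  let : MeasurableSpace E := borel E
  have : BorelSpace E := ⟨rfl⟩
  let G : ℕ → Set ((ℕ → ℝ) × E) := fun K =>
    {z | Filter.Tendsto (fun N => partialSum x z.1 N - z.2) Filter.atTop (𝓝 0)} ∩
      ⋂ N, {z | p n (partialSum x z.1 N) ≤ K}
  have hcont (N : ℕ) : Continuous fun z : (ℕ → ℝ) × E => partialSum x z.1 N :=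
    (continuous_partialSum x N).comp continuous_fst
  have hG (K : ℕ) : MeasurableSet (G K) := by
    refine (measurableSet_tendsto _ fun N =>
      ((hcont N).sub continuous_snd).measurable).inter (MeasurableSet.iInter fun N => ?_)
    exact (isClosed_le ((hp n).comp (hcont N)) continuous_const).measurableSet
  have hinj (K : ℕ) : InjOn Prod.snd (G K) := by
    rintro ⟨a, y⟩ ⟨ha, -⟩ ⟨b, y'⟩ ⟨hb, -⟩ (rfl : y = y')
    have ha' := tendsto_sub_nhds_zero_iff.1 (Set.mem_ofPred_eq ▸ ha)
    have hb' := tendsto_sub_nhds_zero_iff.1 (Set.mem_ofPred_eq ▸ hb)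
    exact congrArg (·, y) ((hx y).unique ha' hb')
  have hA (K : ℕ) : BaireMeasurableSet (Prod.snd '' G K) :=
    ((hG K).image_of_continuousOn_injOn continuous_snd.continuousOn
      (hinj K)).baireMeasurableSet
  have hcover : ⋃ K, Prod.snd '' G K = Set.univ := by
    refine Set.eq_univ_of_forall fun y => ?_
    obtain ⟨a, ha, -⟩ := hx y
    obtain ⟨C, hC⟩ := (((hp n).tendsto y).comp ha).bddAbove_range
    obtain ⟨K, hK⟩ := exists_nat_ge C
    refine Set.mem_iUnion.2 ⟨K, (a, y), ⟨tendsto_sub_nhds_zero_iff.2 ha, ?_⟩, rfl⟩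
    exact Set.mem_iInter.2 fun N => (hC ⟨N, rfl⟩).trans hK
  obtain ⟨K, hK⟩ : ∃ K, ¬ IsMeagre (Prod.snd '' G K) := by
    by_contra! hall
    exact not_isMeagre_of_isOpen (isOpen_univ (X := E)) ⟨0, trivial⟩
      (hcover ▸ isMeagre_iUnion hall)
  refine ⟨K + K, ?_⟩
  filter_upwards [sub_mem_nhds_zero_of_not_isMeagre (hA K) hK]
  rintro y ⟨u, ⟨⟨a, _⟩, ⟨ha, haK⟩, rfl⟩, v, ⟨⟨b, _⟩, ⟨hb, hbK⟩, rfl⟩, rfl⟩ c hc N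
  have hab : Filter.Tendsto (partialSum x (a - b)) Filter.atTop (𝓝 _) :=
    ((tendsto_sub_nhds_zero_iff.1 ha).sub (tendsto_sub_nhds_zero_iff.1 hb)).congr
      fun N => (partialSum_sub x a b N).symm
  rw [(hx _).unique hc hab, partialSum_sub]
  push_cast
  exact (map_sub_le_add (p n) _ _).trans
    (add_le_add (Set.mem_iInter.1 haK N) (Set.mem_iInter.1 hbK N))

/-- Every Schauder basis of a Polish locally convex space satisfies the Grunblum condition. -/
theorem isBasic_of_basis [PolishSpace E] (hp : IsFundamental p)
    (hx : ∀ y : E, ∃! a : ℕ → ℝ, Filter.Tendsto (partialSum x a) Filter.atTop (𝓝 y)) :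
    IsBasic p x := by
  constructor
  · intro j hj
    have h0 : Filter.Tendsto (partialSum x 0) Filter.atTop (𝓝 0) := by
      simp [funext (partialSum_zero_coeff x)]
    have h1 : Filter.Tendsto (partialSum x (Pi.single j 1)) Filter.atTop (𝓝 0) := by
      have : partialSum x (Pi.single j 1) = fun _ => 0 := by
        funext N
        refine Finset.sum_eq_zero fun i _ => ?_
        rcases eq_or_ne i j with rfl | h
        · simp [hj]
        · simp [h]
      simp [this]
    simpa using congrFun ((hx 0).unique h0 h1) j
  · intro n
    obtain ⟨K, hK⟩ := exists_partialSum_bound_nhds hp.continuous hx n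
    obtain ⟨m, ε, hε, hsub⟩ := hp.exists_ball_subset _ hK
    obtain ⟨C, hC⟩ := exists_nat_ge (K / ε)
    refine ⟨m, C, fun k l hkl a => ?_⟩
    have hscale (t : ℝ) (ht : 0 < t) (h : t * p m (partialSum x a l) < ε) :
        t * p n (partialSum x a k) ≤ K := by
      have h1 := hsub (t • partialSum x a l)
        (by rwa [map_smul_eq_mul, Real.norm_of_nonneg ht.le])
        (t • (Set.Iio l).indicator a) (by
          refine tendsto_const_nhds.congr' ?_
          filter_upwards [Filter.eventually_ge_atTop l] with N hN
          rw [partialSum_smul, partialSum_indicator, min_eq_right hN]) k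
      rwa [partialSum_smul, partialSum_indicator, min_eq_left hkl, map_smul_eq_mul,
        Real.norm_of_nonneg ht.le] at h1
    refine le_trans ?_ (mul_le_mul_of_nonneg_right hC (apply_nonneg (p m) _))
    refine le_of_forall_gt_imp_ge_of_dense fun s hs => ?_
    have hKs : K * p m (partialSum x a l) < ε * s := by
      rw [div_mul_eq_mul_div, div_lt_iff₀ hε] at hs
      linarith
    have hs0 : 0 < s := lt_of_le_of_lt (by positivity) hs
    by_contra! hlt
    have hpos : 0 < p n (partialSum x a k) := hs0.trans hlt
    obtain ⟨t, ht1, ht2⟩ : ∃ t, K / p n (partialSum x a k) < t ∧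
        t * p m (partialSum x a l) < ε := by
      rcases (apply_nonneg (p m) (partialSum x a l)).eq_or_lt with h | h
      · exact ⟨K / p n (partialSum x a k) + 1, by linarith, by rw [← h]; simpa using hε⟩
      · obtain ⟨t, h1, h2⟩ := exists_between
          (show K / p n (partialSum x a k) < ε / p m (partialSum x a l) by
            rw [div_lt_div_iff₀ hpos h]
            nlinarith)
        exact ⟨t, h1, (lt_div_iff₀ h).1 h2⟩
    have ht0 : 0 < t := lt_of_le_of_lt (by positivity) ht1
    have := hscale t ht0 ht2
    rw [div_lt_iff₀ hpos] at ht1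
    linarith

theorem IsBasic.coeff_unique [T2Space E] (hp : IsFundamental p) (hx : IsBasic p x) {y : E}
    {a b : ℕ → ℝ} (ha : Filter.Tendsto (partialSum x a) Filter.atTop (𝓝 y))
    (hb : Filter.Tendsto (partialSum x b) Filter.atTop (𝓝 y)) : a = b := by
  have hab : Filter.Tendsto (partialSum x (a - b)) Filter.atTop (𝓝 0) := by
    simpa [funext (partialSum_sub x a b)] using ha.sub hb
  funext j
  obtain ⟨m, C, h⟩ := hx.exists_coeff_bound hp j
  have hlim : Filter.Tendsto (fun l => C * p m (partialSum x (a - b) l)) Filter.atTop (𝓝 0) := by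
    simpa using (hp.tendsto_zero_iff.1 hab m).const_mul C
  have : |(a - b) j| ≤ 0 := by
    refine ge_of_tendsto hlim ?_
    filter_upwards [Filter.eventually_gt_atTop j] with l hl using h l hl _
  simpa [sub_eq_zero] using this

theorem IsBasic.exists_expansion [T2Space E] [FirstCountableTopology E] (hp : IsFundamental p)
    (hx : IsBasic p x) {y : E} (hy : y ∈ closure (Submodule.span ℝ (Set.range x) : Set E)) :
    ∃ a : ℕ → ℝ, Filter.Tendsto (partialSum x a) Filter.atTop (𝓝 y) := by
  obtain ⟨u, hu, hlim⟩ := mem_closure_iff_seq_limit.1 hy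
  choose c L hc using fun i => (mem_span_range_iff_partialSum x).1 (hu i)
  have hdiff (i i' l : ℕ) (h : L i ≤ l) (h' : L i' ≤ l) :
      partialSum x (c i - c i') l = (u i - y) - (u i' - y) := by
    rw [partialSum_sub, hc i l h, hc i' l h']; abel
  have hsem := hp.tendsto_iff.1 hlim
  have hcauchy (j : ℕ) : CauchySeq fun i => c i j := by
    obtain ⟨m, C, h⟩ := hx.exists_coeff_bound hp j
    have hbound (i i' : ℕ) : |c i j - c i' j| ≤ C * p m ((u i - y) - (u i' - y)) := by
      have := h (max (j + 1) (max (L i) (L i'))) (by simp) (c i - c i')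
      rwa [hdiff i i' _ (by simp) (by simp)] at this
    have hs := hp.tendsto_zero_iff.1
      (((tendsto_sub_nhds_zero_iff.2 hlim).comp Filter.tendsto_fst).sub
        ((tendsto_sub_nhds_zero_iff.2 hlim).comp Filter.tendsto_snd) |>.trans_eq (by simp)) m
    rw [cauchySeq_iff_tendsto_dist_atTop_0, ← Filter.prod_atTop_atTop_eq]
    exact squeeze_zero (fun _ => dist_nonneg) (fun z => hbound z.1 z.2)
      (by simpa using hs.const_mul C)
  choose a ha using fun j => cauchySeq_tendsto_of_complete (hcauchy j)
  refine ⟨a, hp.tendsto_iff.2 fun n => ?_⟩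
  obtain ⟨m, C, h⟩ := hx.bound n
  have hest (i k : ℕ) : p n (partialSum x (c i) k - partialSum x a k) ≤ C * p m (u i - y) := by
    have hca : Filter.Tendsto c Filter.atTop (𝓝 a) := tendsto_pi_nhds.2 ha
    have h1 : Filter.Tendsto
        (fun i' => p n (partialSum x (c i) k - partialSum x (c i') k)) Filter.atTop
        (𝓝 (p n (partialSum x (c i) k - partialSum x a k))) :=
      ((hp.continuous n).tendsto _).comp
        (tendsto_const_nhds.sub (((continuous_partialSum x k).tendsto a).comp hca))
    have h2 : Filter.Tendsto (fun i' => C * p m ((u i - y) - (u i' - y))) Filter.atTop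
        (𝓝 (C * p m (u i - y))) := by
      have h3 := ((hp.continuous m).tendsto _).comp
        ((tendsto_const_nhds (x := u i - y)).sub (tendsto_sub_nhds_zero_iff.2 hlim))
      rw [sub_zero] at h3
      exact h3.const_mul _
    refine le_of_tendsto_of_tendsto' h1 h2 fun i' => ?_
    rw [← partialSum_sub, ← hdiff i i' (max k (max (L i) (L i'))) (by simp) (by simp)]
    exact h _ _ (le_max_left _ _) _
  have hsum : Filter.Tendsto (fun i => C * p m (u i - y) + p n (u i - y)) Filter.atTop (𝓝 0) := by
    simpa using ((hsem m).const_mul (C : ℝ)).add (hsem n)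
  refine tendsto_order.2 ⟨fun e he => Filter.Eventually.of_forall fun k =>
    he.trans_le (apply_nonneg _ _), fun e he => ?_⟩
  obtain ⟨i, hi⟩ := (hsum.eventually_lt_const he).exists
  filter_upwards [Filter.eventually_ge_atTop (L i)] with k hk
  have hek := hest i k
  rw [hc i k hk] at hek
  calc p n (partialSum x a k - y)
      = p n ((u i - y) - (u i - partialSum x a k)) := by congr 1; abel
    _ ≤ p n (u i - y) + p n (u i - partialSum x a k) := map_sub_le_add _ _ _
    _ < e := by linarith

theorem isBasic_measurableSet [T2Space E] [MeasurableSpace (ℕ → E)] [BorelSpace (ℕ → E)]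
    (hp : ∀ n, Continuous (p n)) : MeasurableSet {x : ℕ → E | IsBasic p x} := by
  have : {x : ℕ → E | IsBasic p x} = (⋂ j, {x : ℕ → E | x j ≠ 0}) ∩
      ⋂ n, ⋃ m : ℕ, ⋃ C : ℕ, ⋂ k, ⋂ l, ⋂ _ : k ≤ l, ⋂ a : ℕ → ℝ,
        {x : ℕ → E | p n (partialSum x a k) ≤ C * p m (partialSum x a l)} := by
    ext x
    simp only [Set.mem_inter_iff, Set.mem_iInter, Set.mem_iUnion, Set.mem_ofPred_eq]
    exact ⟨fun h => ⟨h.ne_zero, h.bound⟩, fun h => ⟨h.1, h.2⟩⟩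
  rw [this]
  refine (MeasurableSet.iInter fun j => ?_).inter (MeasurableSet.iInter fun n =>
    MeasurableSet.iUnion fun m => MeasurableSet.iUnion fun C => IsClosed.measurableSet ?_)
  · exact (isOpen_ne_fun (continuous_apply j) continuous_const).measurableSet
  · refine isClosed_iInter fun k => isClosed_iInter fun l => isClosed_iInter fun _ =>
      isClosed_iInter fun a => ?_
    exact isClosed_le ((hp n).comp (continuous_partialSum_vectors a k))
      (continuous_const.mul ((hp m).comp (continuous_partialSum_vectors a l)))

end Topology

/-- The supremum seminorm over `[-n, n]` on `C(ℝ)`. -/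
def supSeminorm (n : ℕ) : Seminorm ℝ CR :=
  (normSeminorm ℝ C(Set.Icc (-(n : ℝ)) n, ℝ)).comp
    ({ toFun := fun f => f.restrict (Set.Icc (-(n : ℝ)) n)
       map_add' := fun _ _ => rfl
       map_smul' := fun _ _ => rfl } : CR →ₗ[ℝ] C(Set.Icc (-(n : ℝ)) n, ℝ))

theorem supSeminorm_apply (n : ℕ) (f : CR) :
    supSeminorm n f = ‖f.restrict (Set.Icc (-(n : ℝ)) n)‖ := rfl

theorem supSeminorm_isFundamental : IsFundamental supSeminorm := by
  constructor
  · intro n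
    exact (continuous_norm (E := C(Set.Icc (-(n : ℝ)) n, ℝ))).comp
      (ContinuousMap.continuous_restrict _)
  · intro U hU
    obtain ⟨⟨K, V⟩, ⟨hK, hV⟩, hsub⟩ :=
      (nhds_basis_uniformity' ContinuousMap.hasBasis_compactConvergenceUniformity).mem_iff.1 hU
    obtain ⟨ε, hε, hεV⟩ := Metric.mem_uniformity_dist.1 hV
    obtain ⟨r, hr⟩ := hK.isBounded.subset_closedBall 0
    obtain ⟨n, hn⟩ := exists_nat_ge r
    refine ⟨n, ε, hε, fun f hf => hsub ?_⟩
    intro t ht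
    have ht' : t ∈ Set.Icc (-(n : ℝ)) n := by
      have := hr ht
      rw [mem_closedBall_zero_iff, Real.norm_eq_abs] at this
      exact abs_le.1 (this.trans hn)
    apply hεV
    have h1 := (f.restrict (Set.Icc (-(n : ℝ)) n)).norm_coe_le_norm ⟨t, ht'⟩
    rw [dist_comm]
    rw [supSeminorm_apply] at hf
    simpa using h1.trans_lt hf

/-- The closed linear span of a sequence in `C(ℝ)`. -/
def closedSpan (x : ℕ → CR) : SF :=
  ⟨(Submodule.span ℝ (Set.range x)).topologicalClosure,
    Submodule.isClosed_topologicalClosure _⟩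

theorem measurable_closedSpan [MeasurableSpace (ℕ → CR)] [BorelSpace (ℕ → CR)] :
    Measurable closedSpan := by
  refine measurable_generateFrom ?_
  rintro _ ⟨U, hU, rfl⟩
  have : closedSpan ⁻¹' {X : SF | (((X : Submodule ℝ CR) : Set CR) ∩ U).Nonempty} =
      ⋃ (a : ℕ → ℝ) (N : ℕ), (fun x => partialSum x a N) ⁻¹' U := by
    ext x
    simp only [Set.mem_preimage, Set.mem_ofPred_eq, Set.mem_iUnion]
    change (closure (Submodule.span ℝ (Set.range x) : Set CR) ∩ U).Nonempty ↔ _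
    rw [closure_inter_open_nonempty_iff hU]
    constructor
    · rintro ⟨y, hy, hyU⟩
      obtain ⟨a, N, h⟩ := (mem_span_range_iff_partialSum x).1 hy
      exact ⟨a, N, (h N le_rfl).symm ▸ hyU⟩
    · rintro ⟨a, N, h⟩
      exact ⟨_, partialSum_mem_span x a N, h⟩
  rw [this]
  exact (isOpen_iUnion fun a => isOpen_iUnion fun N =>
    hU.preimage (continuous_partialSum_vectors a N)).measurableSet

theorem hasSchauderBasis_closedSpan {x : ℕ → CR} (hx : IsBasic supSeminorm x) :
    HasSchauderBasis (closedSpan x) := by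
  let x' : ℕ → ↥(closedSpan x : Submodule ℝ CR) := fun j =>
    ⟨x j, subset_closure (Submodule.subset_span (Set.mem_range_self j))⟩
  have key (a : ℕ → ℝ) (y : ↥(closedSpan x : Submodule ℝ CR)) :
      Filter.Tendsto (partialSum x' a) Filter.atTop (𝓝 y) ↔
        Filter.Tendsto (partialSum x a) Filter.atTop (𝓝 (y : CR)) := by
    rw [tendsto_subtype_rng]
    exact Iff.of_eq (congrArg (Filter.Tendsto · _ _)
      (funext fun N => map_partialSum x' (Submodule.subtype _) a N))
  refine ⟨x', fun y => ?_⟩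
  obtain ⟨a, ha⟩ := hx.exists_expansion supSeminorm_isFundamental y.2
  refine ⟨a, (key a y).2 ha, fun b hb => ?_⟩
  exact hx.coeff_unique supSeminorm_isFundamental ((key b y).1 hb) ha

theorem exists_isBasic_of_hasSchauderBasis {X : SF} (hX : HasSchauderBasis X) :
    ∃ x : ℕ → CR, IsBasic supSeminorm x ∧ closedSpan x = X := by
  obtain ⟨x, hx⟩ := hX
  let ι := (X : Submodule ℝ CR).subtype
  let q : ℕ → Seminorm ℝ ↥(X : Submodule ℝ CR) := fun n => (supSeminorm n).comp ι
  have hq : IsFundamental q := by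
    refine ⟨fun n => (supSeminorm_isFundamental.continuous n).comp continuous_subtype_val,
      fun U hU => ?_⟩
    obtain ⟨V, hV, hVU⟩ := mem_nhds_subtype _ _ _ |>.1 hU
    obtain ⟨m, ε, hε, h⟩ := supSeminorm_isFundamental.exists_ball_subset V hV
    exact ⟨m, ε, hε, fun y hy => hVU (h _ hy)⟩
  have : PolishSpace ↥(X : Submodule ℝ CR) := IsClosed.polishSpace X.2
  have hb : IsBasic q x := isBasic_of_basis hq hx
  refine ⟨fun j => x j, ⟨fun j h => hb.ne_zero j (Subtype.ext h), fun n => ?_⟩, ?_⟩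
  · obtain ⟨m, C, h⟩ := hb.bound n
    refine ⟨m, C, fun k l hkl a => ?_⟩
    have := h k l hkl a
    simp only [q, Seminorm.comp_apply, map_partialSum] at this
    exact this
  · refine Subtype.ext (le_antisymm ?_ fun y hy => ?_)
    · refine Submodule.topologicalClosure_minimal _ (Submodule.span_le.2 ?_) X.2
      rintro _ ⟨j, rfl⟩
      exact (x j).2
    · obtain ⟨a, ha, -⟩ := hx ⟨y, hy⟩
      refine mem_closure_of_tendsto ((continuous_subtype_val.tendsto _).comp ha)
        (Filter.Eventually.of_forall fun N => ?_)
      have := partialSum_mem_span (fun j => ι (x j)) a N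
      rw [← map_partialSum x ι a N] at this
      exact this

/-- `SF_b = {X ∈ SF : X has a Schauder basis}` is analytic in `SF`. -/
theorem basis_analytic : IsAnalyticIn {X : SF | HasSchauderBasis X} := by
  let : MeasurableSpace (ℕ → CR) := borel (ℕ → CR)
  have : BorelSpace (ℕ → CR) := ⟨rfl⟩
  have hB : MeasurableSet {x : ℕ → CR | IsBasic supSeminorm x} :=
    isBasic_measurableSet supSeminorm_isFundamental.continuous
  obtain ⟨Z, tZ, hZ, g, hg, hrange⟩ :=
    analyticSet_iff_exists_polishSpace_range.1 hB.analyticSet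
  refine ⟨Z, tZ, hZ, closedSpan ∘ g, ?_, ?_⟩
  · let : MeasurableSpace Z := borel Z
    have : BorelSpace Z := ⟨rfl⟩
    exact measurable_closedSpan.comp hg.measurable
  · rw [Set.range_comp, hrange]
    ext X
    constructor
    · rintro ⟨x, hx, rfl⟩
      exact hasSchauderBasis_closedSpan hx
    · intro hX
      obtain ⟨x, hx, rfl⟩ := exists_isBasic_of_hasSchauderBasis hX
      exact ⟨x, hx, rfl⟩
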